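/- Integral-remainder formula for Wasserstein gradients: let φ: P₂(ℝ^d) → ℝ, μ* ∈ P_c(ℝ^d) and w ∈ L^∞(ℝ^d,ℝ^d;μ*). Set ν* = (Id + w)_#μ* and μ^θ = (Id + θw)_#μ* for θ ∈ [0,1]. If φ is Wasserstein differentiable (at every measure) and the map (μ,ζ) ↦ D_μφ[μ](ζ) is continuous, then φ(ν*) − φ(μ*) = ∫_{ℝ^d} D_μφ[μ*](ζ) · w(ζ) dμ*(ζ) + R(μ*,w), where R(μ*,w) = ∫₀¹ ∫_{ℝ^d} (D_μφ[μ^θ](ζ + θw(ζ)) − D_μφ[μ*](ζ)) · w(ζ) dμ*(ζ) dθ. -/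

import Mathlib

/-!
Common definitions: 2-Wasserstein distance, compactly supported probability
measures, the coupled PDE–ODE control system of sparse mean-field control
(weak measure solutions, non-local flows), Wasserstein differentiability,
the linearized operators and their adjoints.
-/

open MeasureTheory Set Metric Filter
open scoped RealInnerProductSpace ENNReal Topology

noncomputable section

/-- Euclidean space `ℝ^n`. -/
abbrev Rd (n : ℕ) : Type := EuclideanSpace ℝ (Fin n)

namespace WC

/-! ### Optimal transport basics -/

/-- `γ` is a coupling of `μ` and `ν`. -/
def IsCoupling {n : ℕ} (γ : Measure (Rd n × Rd n)) (μ ν : Measure (Rd n)) : Prop :=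
  γ.fst = μ ∧ γ.snd = ν

/-- Square-root of the quadratic transport cost of a coupling. -/
def transportCost {n : ℕ} (γ : Measure (Rd n × Rd n)) : ℝ :=
  Real.sqrt (∫ p, ‖p.1 - p.2‖ ^ 2 ∂γ)

/-- The 2-Wasserstein distance. -/
def W2 {n : ℕ} (μ ν : Measure (Rd n)) : ℝ :=
  sInf { r : ℝ | ∃ γ : Measure (Rd n × Rd n), IsCoupling γ μ ν ∧ r = transportCost γ }

/-- `γ` is an optimal coupling of `μ` and `ν`. -/
def IsOptCoupling {n : ℕ} (γ : Measure (Rd n × Rd n)) (μ ν : Measure (Rd n)) : Prop :=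
  IsCoupling γ μ ν ∧ transportCost γ = W2 μ ν

/-- `Tm` is an optimal transport map from `μ` to `ν`. -/
def IsOptimalTransportMap {n : ℕ} (Tm : Rd n → Rd n) (μ ν : Measure (Rd n)) : Prop :=
  Measurable Tm ∧ Measure.map Tm μ = ν ∧
    Real.sqrt (∫ x, ‖x - Tm x‖ ^ 2 ∂μ) = W2 μ ν

/-- Probability measures with finite second moment. -/
def IsP2 {n : ℕ} (μ : Measure (Rd n)) : Prop :=
  IsProbabilityMeasure μ ∧ Integrable (fun x => ‖x‖ ^ 2) μ

/-- Compactly supported probability measures. -/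
def IsPc {n : ℕ} (μ : Measure (Rd n)) : Prop :=
  IsProbabilityMeasure μ ∧ ∃ R : ℝ, μ (closedBall (0 : Rd n) R)ᶜ = 0

/-- The radius `m_∞(μ)` of the support of `μ`. -/
def mSupp {n : ℕ} (μ : Measure (Rd n)) : ℝ :=
  sInf { R : ℝ | 0 ≤ R ∧ μ (closedBall (0 : Rd n) R)ᶜ = 0 }

/-- A function into `ℝ^n` is (uniformly) bounded. -/
def BddFun {α : Type*} {n : ℕ} (f : α → Rd n) : Prop := ∃ B : ℝ, ∀ a, ‖f a‖ ≤ B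

/-! ### Wasserstein differentiability -/

/-- Membership in the tangent space `Tan_μ P₂(ℝ^n)`: `ξ` lies in the `L²(μ)`-closure of
gradients of smooth compactly supported functions. -/
def InTangent {n : ℕ} (μ : Measure (Rd n)) (ξ : Rd n → Rd n) : Prop :=
  ∀ ε > (0 : ℝ), ∃ ψ : Rd n → ℝ, ContDiff ℝ (⊤ : ℕ∞) ψ ∧ HasCompactSupport ψ ∧
    ∫ x, ‖ξ x - gradient ψ x‖ ^ 2 ∂μ < ε

/-- `φ : P₂(ℝ^n) → ℝ` is Wasserstein differentiable at `μ` with Wasserstein gradient `ξ`: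
`ξ` is tangent at `μ` and a first-order expansion along optimal couplings holds. -/
def HasWGradAt {n : ℕ} (φ : Measure (Rd n) → ℝ) (μ : Measure (Rd n)) (ξ : Rd n → Rd n) :
    Prop :=
  InTangent μ ξ ∧
  ∀ ε > (0 : ℝ), ∃ δ > (0 : ℝ), ∀ ν : Measure (Rd n), IsP2 ν →
    ∀ γ : Measure (Rd n × Rd n), IsOptCoupling γ μ ν → W2 μ ν < δ →
      |φ ν - φ μ - ∫ p, ⟪ξ p.1, p.2 - p.1⟫ ∂γ| ≤ ε * W2 μ ν

/-! ### The coupled PDE–ODE control system -/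

variable {d c : ℕ}

/-- Assumption (LIP): Lipschitz continuity of the fields `F` and `G`. -/
def LIP (F : Measure (Rd d) → Rd d → Rd c → Rd d)
    (G : Measure (Rd d) → Rd c → Rd c) (L : ℝ) : Prop :=
  0 < L ∧
  (∀ μ₁ μ₂ : Measure (Rd d), IsPc μ₁ → IsPc μ₂ → ∀ x₁ x₂ : Rd d, ∀ y₁ y₂ : Rd c,
    ‖F μ₁ x₁ y₁ - F μ₂ x₂ y₂‖ ≤ L * (‖x₁ - x₂‖ + (W2 μ₁ μ₂ + ‖y₁ - y₂‖))) ∧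
  (∀ μ₁ μ₂ : Measure (Rd d), IsPc μ₁ → IsPc μ₂ → ∀ y₁ y₂ : Rd c,
    ‖G μ₁ y₁ - G μ₂ y₂‖ ≤ L * (W2 μ₁ μ₂ + ‖y₁ - y₂‖))

/-- Assumption (SLG): sublinear growth of the fields `F` and `G`. -/
def SLG (F : Measure (Rd d) → Rd d → Rd c → Rd d)
    (G : Measure (Rd d) → Rd c → Rd c) (C : ℝ) : Prop :=
  0 < C ∧
  (∀ μ : Measure (Rd d), IsPc μ → ∀ (x : Rd d) (y : Rd c),
    ‖F μ x y‖ ≤ C * (1 + ‖x‖ + ‖y‖ + mSupp μ)) ∧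
  (∀ μ : Measure (Rd d), IsPc μ → ∀ y : Rd c,
    ‖G μ y‖ ≤ C * (1 + ‖y‖ + mSupp μ))

section Control

variable {Y : Type*} [NormedAddCommGroup Y] [NormedSpace ℝ Y] [CompleteSpace Y]

/-- Admissible controls: measurable and with values in `U` on `[0,T]`. -/
def AdmissibleControl [MeasurableSpace Y] (T : ℝ) (U : Set Y) (u : ℝ → Y) : Prop :=
  Measurable u ∧ ∀ t ∈ Icc (0 : ℝ) T, u t ∈ U

/-- Weak measure solution of the coupled PDE–ODE system
`∂ₜμ + ∇ₓ·(F[μ](·,y) μ) = 0`, `ẏ = G[μ](y) + u` on `[0,T]`. -/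
structure IsWeakSolution (T : ℝ) (F : Measure (Rd d) → Rd d → Y → Rd d)
    (G : Measure (Rd d) → Y → Y) (u : ℝ → Y)
    (μ : ℝ → Measure (Rd d)) (y : ℝ → Y) : Prop where
  /-- each `μ t` is a probability measure -/
  prob : ∀ t ∈ Icc (0 : ℝ) T, IsProbabilityMeasure (μ t)
  /-- the measures are equi-compactly supported -/
  equiSupp : ∃ R : ℝ, 0 < R ∧ ∀ t ∈ Icc (0 : ℝ) T, (μ t) (closedBall (0 : Rd d) R)ᶜ = 0
  /-- the continuity equation holds in duality with test functions -/
  pde : ∀ φ : ℝ × Rd d → ℝ, ContDiff ℝ (⊤ : ℕ∞) φ → HasCompactSupport φ →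
    tsupport φ ⊆ Ioo (0 : ℝ) T ×ˢ (univ : Set (Rd d)) →
    ∫ t in Icc (0 : ℝ) T, ∫ x, (deriv (fun s => φ (s, x)) t
      + fderiv ℝ (fun z => φ (t, z)) x (F (μ t) x (y t))) ∂(μ t) = 0
  /-- continuity of the controlled trajectory -/
  yCont : ContinuousOn y (Icc (0 : ℝ) T)
  /-- `y` is a Carathéodory solution of the controlled ODE -/
  ode : ∀ s ∈ Icc (0 : ℝ) T, ∀ t ∈ Icc (0 : ℝ) T,
    y t = y s + ∫ τ in s..t, (G (μ τ) (y τ) + u τ)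

/-- Solution of the Cauchy problem with data `(t₀, μ₀, y₀, u)`. -/
def IsCauchySolution (T : ℝ) (F : Measure (Rd d) → Rd d → Y → Rd d)
    (G : Measure (Rd d) → Y → Y) (u : ℝ → Y) (t₀ : ℝ)
    (μ₀ : Measure (Rd d)) (y₀ : Y) (μ : ℝ → Measure (Rd d)) (y : ℝ → Y) : Prop :=
  IsWeakSolution T F G u μ y ∧ μ t₀ = μ₀ ∧ y t₀ = y₀

/-- Lagrangian (non-local flow) representation for the measure component. -/
structure IsFlowFor (T : ℝ) (F : Measure (Rd d) → Rd d → Y → Rd d) (t₀ : ℝ)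
    (μ₀ : Measure (Rd d)) (μ : ℝ → Measure (Rd d)) (y : ℝ → Y)
    (Φ : ℝ → Rd d → Rd d) : Prop where
  meas : ∀ t ∈ Icc (0 : ℝ) T, Measurable (Φ t)
  init : ∀ x : Rd d, Φ t₀ x = x
  flowOde : ∀ x : Rd d, ∀ t ∈ Icc (0 : ℝ) T,
    Φ t x = x + ∫ s in t₀..t, F (μ s) (Φ s x) (y s)
  push : ∀ t ∈ Icc (0 : ℝ) T, μ t = Measure.map (Φ t) μ₀

end Control

/-- Weak convergence in `L²([0,T], ℝ^c)` of a sequence of controls. -/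
def WeakL2Conv (T : ℝ) (uN : ℕ → ℝ → Rd c) (u : ℝ → Rd c) : Prop :=
  ∀ g : ℝ → Rd c, Measurable g → IntegrableOn (fun t => ‖g t‖ ^ 2) (Icc (0 : ℝ) T) →
    Tendsto (fun N => ∫ t in Icc (0 : ℝ) T, ⟪uN N t, g t⟫) atTop
      (𝓝 (∫ t in Icc (0 : ℝ) T, ⟪u t, g t⟫))

/-! ### Derivative data and the linearized/adjoint systems -/

/-- Collection of the derivatives of the vector fields `F` and `G`:
`DxF`, `DyF` (classical derivatives), `DmuF`, `DmuG` (Wasserstein differentials,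
as matrix fields acting on displacements) and `DyG`. -/
structure DerivData (d c : ℕ) where
  DxF : Measure (Rd d) → Rd d → Rd c → (Rd d →L[ℝ] Rd d)
  DyF : Measure (Rd d) → Rd d → Rd c → (Rd c →L[ℝ] Rd d)
  DmuF : Measure (Rd d) → Rd d → Rd c → Rd d → (Rd d →L[ℝ] Rd d)
  DyG : Measure (Rd d) → Rd c → (Rd c →L[ℝ] Rd c)
  DmuG : Measure (Rd d) → Rd c → Rd d → (Rd d →L[ℝ] Rd c)

/-- Assumptions (H1)–(H2): `F`, `G` are differentiable in `x` and `y` with derivatives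
given by the data `D`, and these derivatives are continuous in all variables
(with respect to `W₂` in the measure variable). -/
def H1H2 (F : Measure (Rd d) → Rd d → Rd c → Rd d) (G : Measure (Rd d) → Rd c → Rd c)
    (D : DerivData d c) : Prop :=
  (∀ μ : Measure (Rd d), IsPc μ → ∀ (x : Rd d) (y : Rd c),
    HasFDerivAt (fun p : Rd d × Rd c => F μ p.1 p.2)
      ((D.DxF μ x y).comp (ContinuousLinearMap.fst ℝ (Rd d) (Rd c))
        + (D.DyF μ x y).comp (ContinuousLinearMap.snd ℝ (Rd d) (Rd c))) (x, y)) ∧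
  (∀ μ : Measure (Rd d), IsPc μ → ∀ y : Rd c, HasFDerivAt (G μ) (D.DyG μ y) y) ∧
  (∀ μ : Measure (Rd d), IsPc μ → ∀ (x : Rd d) (y : Rd c), ∀ ε > (0 : ℝ), ∃ δ > (0 : ℝ),
    ∀ μ' : Measure (Rd d), IsPc μ' → ∀ (x' : Rd d) (y' : Rd c),
      W2 μ μ' + ‖x - x'‖ + ‖y - y'‖ < δ →
      ‖D.DxF μ' x' y' - D.DxF μ x y‖ + ‖D.DyF μ' x' y' - D.DyF μ x y‖ < ε) ∧
  (∀ μ : Measure (Rd d), IsPc μ → ∀ y : Rd c, ∀ ε > (0 : ℝ), ∃ δ > (0 : ℝ),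
    ∀ μ' : Measure (Rd d), IsPc μ' → ∀ y' : Rd c,
      W2 μ μ' + ‖y - y'‖ < δ → ‖D.DyG μ' y' - D.DyG μ y‖ < ε)

/-- Assumption (H3): the maps `μ ↦ F[μ](x,y)` and `μ ↦ G[μ](y)` are Wasserstein
differentiable (componentwise) with differentials given by the data `D`, and these
Wasserstein differentials are continuous in all their variables. -/
def H3 (F : Measure (Rd d) → Rd d → Rd c → Rd d) (G : Measure (Rd d) → Rd c → Rd c)
    (D : DerivData d c) : Prop :=
  (∀ μ : Measure (Rd d), IsPc μ → ∀ (x : Rd d) (y : Rd c) (e : Rd d),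
    HasWGradAt (fun ν => ⟪F ν x y, e⟫) μ
      (fun ζ => ContinuousLinearMap.adjoint (D.DmuF μ x y ζ) e)) ∧
  (∀ μ : Measure (Rd d), IsPc μ → ∀ (y : Rd c) (e : Rd c),
    HasWGradAt (fun ν => ⟪G ν y, e⟫) μ
      (fun ζ => ContinuousLinearMap.adjoint (D.DmuG μ y ζ) e)) ∧
  (∀ μ : Measure (Rd d), IsPc μ → ∀ (x : Rd d) (y : Rd c) (ζ : Rd d), ∀ ε > (0 : ℝ),
    ∃ δ > (0 : ℝ), ∀ μ' : Measure (Rd d), IsPc μ' → ∀ (x' : Rd d) (y' : Rd c) (ζ' : Rd d),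
      W2 μ μ' + ‖x - x'‖ + ‖y - y'‖ + ‖ζ - ζ'‖ < δ →
      ‖D.DmuF μ' x' y' ζ' - D.DmuF μ x y ζ‖ < ε) ∧
  (∀ μ : Measure (Rd d), IsPc μ → ∀ (y : Rd c) (ζ : Rd d), ∀ ε > (0 : ℝ),
    ∃ δ > (0 : ℝ), ∀ μ' : Measure (Rd d), IsPc μ' → ∀ (y' : Rd c) (ζ' : Rd d),
      W2 μ μ' + ‖y - y'‖ + ‖ζ - ζ'‖ < δ → ‖D.DmuG μ' y' ζ' - D.DmuG μ y ζ‖ < ε)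

/-- Reference trajectory data: a Cauchy solution together with its non-local flow. -/
def IsRefSolution (T : ℝ) (F : Measure (Rd d) → Rd d → Rd c → Rd d)
    (G : Measure (Rd d) → Rd c → Rd c) (u : ℝ → Rd c) (t₀ : ℝ)
    (μ₀ : Measure (Rd d)) (y₀ : Rd c) (μs : ℝ → Measure (Rd d)) (ys : ℝ → Rd c)
    (Φ : ℝ → Rd d → Rd d) : Prop :=
  IsCauchySolution T F G u t₀ μ₀ y₀ μs ys ∧ IsFlowFor T F t₀ μ₀ μs ys Φ

/-- The `w`-component of the linearized operator `𝒜(t)`. -/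
def Aw (D : DerivData d c) (μ₀ : Measure (Rd d)) (μs : ℝ → Measure (Rd d))
    (Φ : ℝ → Rd d → Rd d) (ys : ℝ → Rd c) (t : ℝ) (w : Rd d → Rd d) (v : Rd c)
    (x : Rd d) : Rd d :=
  D.DxF (μs t) (Φ t x) (ys t) (w x) + D.DyF (μs t) (Φ t x) (ys t) v
    + ∫ ζ, D.DmuF (μs t) (Φ t x) (ys t) (Φ t ζ) (w ζ) ∂μ₀

/-- The `v`-component of the linearized operator `𝒜(t)`. -/
def Av (D : DerivData d c) (μ₀ : Measure (Rd d)) (μs : ℝ → Measure (Rd d))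
    (Φ : ℝ → Rd d → Rd d) (ys : ℝ → Rd c) (t : ℝ) (w : Rd d → Rd d) (v : Rd c) : Rd c :=
  D.DyG (μs t) (ys t) v + ∫ ζ, D.DmuG (μs t) (ys t) (Φ t ζ) (w ζ) ∂μ₀

/-- Solution (in integral form) of the linearized system
`𝔴̇(t) = 𝒜(t)𝔴(t) + (0, δu(t))`, `𝔴(t₀) = (w₀, v₀)` on `[t₀, T]`. -/
structure IsLinSolution (D : DerivData d c) (μ₀ : Measure (Rd d))
    (μs : ℝ → Measure (Rd d)) (Φ : ℝ → Rd d → Rd d) (ys : ℝ → Rd c) (t₀ T : ℝ)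
    (w₀ : Rd d → Rd d) (v₀ : Rd c) (δu : ℝ → Rd c)
    (w : ℝ → Rd d → Rd d) (v : ℝ → Rd c) : Prop where
  winit : ∀ x, w t₀ x = w₀ x
  vinit : v t₀ = v₀
  weq : ∀ t ∈ Icc t₀ T, ∀ x,
    w t x = w₀ x + ∫ s in t₀..t, Aw D μ₀ μs Φ ys s (w s) (v s) x
  veq : ∀ t ∈ Icc t₀ T,
    v t = v₀ + ∫ s in t₀..t, (Av D μ₀ μs Φ ys s (w s) (v s) + δu s)

/-- The `p`-component of the adjoint operator `𝒜(t)*`. -/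
def AwStar (D : DerivData d c) (μ₀ : Measure (Rd d)) (μs : ℝ → Measure (Rd d))
    (Φ : ℝ → Rd d → Rd d) (ys : ℝ → Rd c) (t : ℝ) (p : Rd d → Rd d) (q : Rd c)
    (x : Rd d) : Rd d :=
  ContinuousLinearMap.adjoint (D.DxF (μs t) (Φ t x) (ys t)) (p x)
    + ContinuousLinearMap.adjoint (D.DmuG (μs t) (ys t) (Φ t x)) q
    + ∫ ζ, ContinuousLinearMap.adjoint (D.DmuF (μs t) (Φ t ζ) (ys t) (Φ t x)) (p ζ) ∂μ₀

/-- The `q`-component of the adjoint operator `𝒜(t)*`. -/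
def AvStar (D : DerivData d c) (μ₀ : Measure (Rd d)) (μs : ℝ → Measure (Rd d))
    (Φ : ℝ → Rd d → Rd d) (ys : ℝ → Rd c) (t : ℝ) (p : Rd d → Rd d) (q : Rd c) : Rd c :=
  (∫ ζ, ContinuousLinearMap.adjoint (D.DyF (μs t) (Φ t ζ) (ys t)) (p ζ) ∂μ₀)
    + ContinuousLinearMap.adjoint (D.DyG (μs t) (ys t)) q

/-- Solution (in integral form) of the backward adjoint equation
`−𝔭̇(t) = 𝒜(t)* 𝔭(t)` on `[τ, T]` with terminal condition `(pT, qT)`. -/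
structure IsAdjointSolution (D : DerivData d c) (μ₀ : Measure (Rd d))
    (μs : ℝ → Measure (Rd d)) (Φ : ℝ → Rd d → Rd d) (ys : ℝ → Rd c) (τ T : ℝ)
    (pT : Rd d → Rd d) (qT : Rd c) (p : ℝ → Rd d → Rd d) (q : ℝ → Rd c) : Prop where
  pterm : ∀ x, p T x = pT x
  qterm : q T = qT
  peq : ∀ t ∈ Icc τ T, ∀ x,
    p t x = pT x + ∫ s in t..T, AwStar D μ₀ μs Φ ys s (p s) (q s) x
  qeq : ∀ t ∈ Icc τ T,
    q t = qT + ∫ s in t..T, AvStar D μ₀ μs Φ ys s (p s) (q s)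

end WC

namespace WC

variable {n : ℕ}

/-! ### Compactly supported measures and couplings -/

theorem integrable_of_ae_mem_isCompact {X : Type*} [TopologicalSpace X] [T2Space X]
    [MeasurableSpace X] [OpensMeasurableSpace X] {m : Measure X} [IsFiniteMeasure m] {K : Set X}
    (hK : IsCompact K) (hm : ∀ᵐ x ∂m, x ∈ K) {f : X → ℝ} (hf : Continuous f) :
    Integrable f m := by
  have h := hf.continuousOn.integrableOn_compact (μ := m) hK
  rwa [IntegrableOn, Measure.restrict_eq_self_of_ae_mem hm] at h

theorem IsPc.exists_isCompact {μ : Measure (Rd n)} (hμ : IsPc μ) :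
    ∃ K : Set (Rd n), IsCompact K ∧ ∀ᵐ x ∂μ, x ∈ K := by
  obtain ⟨-, R, hR⟩ := hμ
  exact ⟨closedBall 0 R, isCompact_closedBall 0 R, by rwa [ae_iff]⟩

theorem IsPc.integrable {μ : Measure (Rd n)} (hμ : IsPc μ) {f : Rd n → ℝ} (hf : Continuous f) :
    Integrable f μ := by
  have := hμ.1
  obtain ⟨K, hK, hμK⟩ := hμ.exists_isCompact
  exact integrable_of_ae_mem_isCompact hK hμK hf

theorem IsPc.isP2 {μ : Measure (Rd n)} (hμ : IsPc μ) : IsP2 μ :=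
  ⟨hμ.1, hμ.integrable (by fun_prop)⟩

theorem IsCoupling.isProbabilityMeasure {γ : Measure (Rd n × Rd n)} {μ ν : Measure (Rd n)}
    (h : IsCoupling γ μ ν) [IsProbabilityMeasure μ] : IsProbabilityMeasure γ := by
  constructor
  rw [← Measure.fst_univ, h.1, measure_univ]

theorem IsCoupling.ae_mem_prod {γ : Measure (Rd n × Rd n)} {μ ν : Measure (Rd n)}
    (h : IsCoupling γ μ ν) {K L : Set (Rd n)} (hK : ∀ᵐ x ∂μ, x ∈ K) (hL : ∀ᵐ x ∂ν, x ∈ L) :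
    ∀ᵐ p ∂γ, p ∈ K ×ˢ L := by
  rw [← h.1, Measure.fst] at hK
  rw [← h.2, Measure.snd] at hL
  filter_upwards [ae_of_ae_map measurable_fst.aemeasurable hK,
    ae_of_ae_map measurable_snd.aemeasurable hL] with p h₁ h₂ using ⟨h₁, h₂⟩

theorem IsCoupling.integrable {γ : Measure (Rd n × Rd n)} {μ ν : Measure (Rd n)}
    (h : IsCoupling γ μ ν) (hμ : IsPc μ) (hν : IsPc ν) {f : Rd n × Rd n → ℝ}
    (hf : Continuous f) : Integrable f γ := by
  have := hμ.1
  have := h.isProbabilityMeasure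
  obtain ⟨K, hK, hμK⟩ := hμ.exists_isCompact
  obtain ⟨L, hL, hνL⟩ := hν.exists_isCompact
  exact integrable_of_ae_mem_isCompact (hK.prod hL) (h.ae_mem_prod hμK hνL) hf

theorem IsCoupling.integral_fst {γ : Measure (Rd n × Rd n)} {μ ν : Measure (Rd n)}
    (h : IsCoupling γ μ ν) {f : Rd n → ℝ} (hf : Continuous f) :
    ∫ p, f p.1 ∂γ = ∫ x, f x ∂μ := by
  rw [← h.1, Measure.fst, integral_map measurable_fst.aemeasurable hf.aestronglyMeasurable]

theorem IsCoupling.integral_snd {γ : Measure (Rd n × Rd n)} {μ ν : Measure (Rd n)}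
    (h : IsCoupling γ μ ν) {f : Rd n → ℝ} (hf : Continuous f) :
    ∫ p, f p.2 ∂γ = ∫ x, f x ∂ν := by
  rw [← h.2, Measure.snd, integral_map measurable_snd.aemeasurable hf.aestronglyMeasurable]

theorem isCoupling_map {m μ ν : Measure (Rd n)} {f g : Rd n → Rd n} (hf : Measurable f)
    (hg : Measurable g) (hμ : m.map f = μ) (hν : m.map g = ν) :
    IsCoupling (m.map fun x => (f x, g x)) μ ν := by
  subst hμ hν
  exact ⟨Measure.fst_map_prodMk hg, Measure.snd_map_prodMk hf⟩

theorem transportCost_nonneg (γ : Measure (Rd n × Rd n)) : 0 ≤ transportCost γ :=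
  Real.sqrt_nonneg _

theorem transportCost_sq (γ : Measure (Rd n × Rd n)) :
    transportCost γ ^ 2 = ∫ p, ‖p.1 - p.2‖ ^ 2 ∂γ :=
  Real.sq_sqrt (integral_nonneg fun _ => sq_nonneg _)

theorem W2_le_transportCost {γ : Measure (Rd n × Rd n)} {μ ν : Measure (Rd n)}
    (h : IsCoupling γ μ ν) : W2 μ ν ≤ transportCost γ :=
  csInf_le ⟨0, by rintro _ ⟨γ, -, rfl⟩; exact transportCost_nonneg γ⟩ ⟨γ, h, rfl⟩

theorem transportCost_map_le {m : Measure (Rd n)} [IsProbabilityMeasure m] {f g : Rd n → Rd n}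
    (hf : Measurable f) (hg : Measurable g) {b : ℝ} (hb : 0 ≤ b) (h : ∀ x, ‖f x - g x‖ ≤ b) :
    transportCost (m.map fun x => (f x, g x)) ≤ b := by
  refine Real.sqrt_le_iff.2 ⟨hb, ?_⟩
  rw [integral_map (hf.prodMk hg).aemeasurable
    (Continuous.aestronglyMeasurable (by fun_prop))]
  calc ∫ x, ‖f x - g x‖ ^ 2 ∂m ≤ ∫ _, b ^ 2 ∂m := by
        refine integral_mono_of_nonneg (ae_of_all _ fun _ => sq_nonneg _)
          (integrable_const _) (ae_of_all _ fun x => ?_)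
        exact pow_le_pow_left₀ (norm_nonneg _) (h x) 2
    _ = b ^ 2 := by simp

theorem W2_nonneg (μ ν : Measure (Rd n)) : 0 ≤ W2 μ ν :=
  Real.sInf_nonneg (by rintro _ ⟨γ, -, rfl⟩; exact transportCost_nonneg γ)

/-- Compactly supported probability measures admit an optimal coupling. -/
theorem exists_isOptCoupling {μ ν : Measure (Rd n)} (hμ : IsPc μ) (hν : IsPc ν) :
    ∃ γ, IsOptCoupling γ μ ν := by
  have := hμ.1
  have := hν.1
  obtain ⟨K, hK, hμK⟩ := hμ.exists_isCompact
  obtain ⟨L, hL, hνL⟩ := hν.exists_isCompact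
  have hKL := hK.prod hL
  let S : Set (ProbabilityMeasure (Rd n × Rd n)) := {γ | IsCoupling (γ : Measure _) μ ν}
  have hSc : IsClosed S := by
    let m₁ : ProbabilityMeasure (Rd n) := ⟨μ, hμ.1⟩
    let m₂ : ProbabilityMeasure (Rd n) := ⟨ν, hν.1⟩
    have hS : S = {γ | γ.map measurable_fst.aemeasurable = m₁} ∩
        {γ | γ.map measurable_snd.aemeasurable = m₂} := by
      ext γ
      exact and_congr (Subtype.ext_iff (a1 := γ.map measurable_fst.aemeasurable) (a2 := m₁)).symm
        (Subtype.ext_iff (a1 := γ.map measurable_snd.aemeasurable) (a2 := m₂)).symm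
    rw [hS]
    exact (isClosed_eq (ProbabilityMeasure.continuous_map continuous_fst) continuous_const).inter
      (isClosed_eq (ProbabilityMeasure.continuous_map continuous_snd) continuous_const)
  have hSt : IsTightMeasureSet
      {((γ : ProbabilityMeasure (Rd n × Rd n)) : Measure (Rd n × Rd n)) | γ ∈ S} := by
    rw [isTightMeasureSet_iff_exists_isCompact_measure_compl_le]
    rintro ε -
    refine ⟨K ×ˢ L, hKL, ?_⟩
    rintro _ ⟨γ, hγ, rfl⟩
    have h := IsCoupling.ae_mem_prod hγ hμK hνL
    rw [ae_iff] at h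
    exact h.le.trans zero_le
  have hScomp : IsCompact S := by
    simpa [hSc.closure_eq] using isCompact_closure_of_isTightMeasureSet hSt
  obtain ⟨M, hM⟩ := hKL.exists_bound_of_continuousOn
    (f := fun p : Rd n × Rd n => ‖p.1 - p.2‖ ^ 2) (by fun_prop)
  let c : BoundedContinuousFunction (Rd n × Rd n) ℝ :=
    BoundedContinuousFunction.ofNormedAddCommGroup (fun p => min (‖p.1 - p.2‖ ^ 2) |M|)
      (by fun_prop) |M| (fun p => by
        rw [Real.norm_of_nonneg (by positivity)]
        exact min_le_right _ _)
  have hcost : ∀ γ ∈ S, transportCost (γ : Measure (Rd n × Rd n)) =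
      √(∫ p, c p ∂(γ : Measure (Rd n × Rd n))) := by
    intro γ hγ
    rw [transportCost]
    congr 1
    refine integral_congr_ae ?_
    filter_upwards [IsCoupling.ae_mem_prod hγ hμK hνL] with p hp
    refine (min_eq_left ?_).symm
    exact (le_abs_self _).trans ((hM p hp).trans (le_abs_self M))
  have hSne : S.Nonempty := by
    refine ⟨⟨μ.prod ν, inferInstance⟩, ?_⟩
    constructor <;> simp [Measure.fst_prod, Measure.snd_prod]
  obtain ⟨γ, hγS, hγ⟩ := hScomp.exists_isMinOn hSne
    ((ProbabilityMeasure.continuous_integral_boundedContinuousFunction c).sqrt).continuousOn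
  refine ⟨γ, hγS, le_antisymm ?_ (W2_le_transportCost hγS)⟩
  refine le_csInf ⟨_, γ, hγS, rfl⟩ ?_
  rintro _ ⟨γ', hγ', rfl⟩
  have hmem : (⟨γ', hγ'.isProbabilityMeasure⟩ : ProbabilityMeasure (Rd n × Rd n)) ∈ S := hγ'
  have h := isMinOn_iff.1 hγ _ hmem
  rw [← hcost _ hγS, ← hcost _ hmem] at h
  exact h

/-! ### Tangent fields and differentiability along arbitrary couplings -/

/-- The gradient of a compactly supported smooth function satisfies a quadratic Taylor bound. -/
theorem exists_abs_sub_sub_inner_gradient_le {ψ : Rd n → ℝ} (hψ : ContDiff ℝ (⊤ : ℕ∞) ψ)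
    (hs : HasCompactSupport ψ) :
    Continuous (gradient ψ) ∧ ∃ C : ℝ, 0 ≤ C ∧
      ∀ x y, |ψ y - ψ x - ⟪gradient ψ x, y - x⟫| ≤ C * ‖x - y‖ ^ 2 := by
  have hd : ContDiff ℝ 1 (fderiv ℝ ψ) := hψ.fderiv_right (by norm_cast)
  refine ⟨(InnerProductSpace.toDual ℝ (Rd n)).symm.continuous.comp hd.continuous, ?_⟩
  obtain ⟨L, hL⟩ := hd.lipschitzWith_of_hasCompactSupport (hs.fderiv ℝ) one_ne_zero
  refine ⟨L, L.2, fun x y => ?_⟩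
  have hdiff : Differentiable ℝ ψ := hψ.differentiable (by simp)
  have h := (convex_segment x y).norm_image_sub_le_of_norm_hasFDerivWithin_le'
    (f := ψ) (f' := fderiv ℝ ψ) (φ := fderiv ℝ ψ x) (C := L * ‖x - y‖)
    (fun z _ => (hdiff z).hasFDerivAt.hasFDerivWithinAt)
    (fun z hz => by
      rw [← dist_eq_norm, ← dist_eq_norm, dist_comm x y]
      refine (hL.dist_le_mul z x).trans ?_
      gcongr
      rw [dist_eq_norm, dist_eq_norm]
      exact norm_sub_le_of_mem_segment hz)
    (left_mem_segment ℝ x y) (right_mem_segment ℝ x y)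
  have hg : ⟪gradient ψ x, y - x⟫ = fderiv ℝ ψ x (y - x) := by
    rw [gradient, InnerProductSpace.toDual_symm_apply]
  rw [hg, ← Real.norm_eq_abs]
  rw [norm_sub_rev y x] at h
  linarith [h]

theorem integral_mul_le_sqrt_mul_sqrt {α : Type*} [MeasurableSpace α] {m : Measure α}
    {f g : α → ℝ} (hf : 0 ≤ f) (hg : 0 ≤ g) (hf2 : MemLp f 2 m) (hg2 : MemLp g 2 m) :
    ∫ x, f x * g x ∂m ≤ √(∫ x, f x ^ 2 ∂m) * √(∫ x, g x ^ 2 ∂m) := by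
  have h := integral_mul_le_Lp_mul_Lq_of_nonneg (μ := m) Real.HolderConjugate.two_two
    (ae_of_all _ hf) (ae_of_all _ hg) (by simpa using hf2) (by simpa using hg2)
  simpa [Real.sqrt_eq_rpow] using h

/-- On a coupling, a tangent field integrates like the increment of a potential, up to an error
which is small relative to the transport cost. -/
theorem exists_abs_integral_inner_sub_le {μ : Measure (Rd n)} (hμ : IsPc μ) {ξ : Rd n → Rd n}
    (hξ : Continuous ξ) (hT : InTangent μ ξ) {ε : ℝ} (hε : 0 < ε) :
    ∃ C : ℝ, 0 ≤ C ∧ ∃ ψ : Rd n → ℝ, ∀ ν, IsPc ν → ∀ γ, IsCoupling γ μ ν →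
      |∫ p, ⟪ξ p.1, p.2 - p.1⟫ ∂γ - (∫ x, ψ x ∂ν - ∫ x, ψ x ∂μ)|
        ≤ ε * transportCost γ + C * transportCost γ ^ 2 := by
  obtain ⟨ψ, hψ, hs, hψε⟩ := hT (ε ^ 2) (by positivity)
  obtain ⟨hgc, C, hC, hCb⟩ := exists_abs_sub_sub_inner_gradient_le hψ hs
  refine ⟨C, hC, ψ, fun ν hν γ hγ => ?_⟩
  have hψc : Continuous ψ := hψ.continuous
  have hint {f : Rd n × Rd n → ℝ} (hf : Continuous f) : Integrable f γ := hγ.integrable hμ hν hf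
  rw [← hγ.integral_snd hψc, ← hγ.integral_fst hψc,
    ← integral_sub (hint (by fun_prop)) (hint (by fun_prop)),
    ← integral_sub (hint (by fun_prop)) (hint (by fun_prop))]
  have hL2 {f : Rd n × Rd n → ℝ} (hf : Continuous f) : MemLp f 2 γ :=
    (memLp_two_iff_integrable_sq hf.aestronglyMeasurable).2 (hint (by fun_prop))
  have hCS : ∫ p, ‖ξ p.1 - gradient ψ p.1‖ * ‖p.1 - p.2‖ ∂γ ≤ ε * transportCost γ := by
    refine (integral_mul_le_sqrt_mul_sqrt (fun _ => norm_nonneg _) (fun _ => norm_nonneg _)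
      (hL2 (by fun_prop)) (hL2 (by fun_prop))).trans ?_
    refine mul_le_mul_of_nonneg_right ?_ (Real.sqrt_nonneg _)
    rw [hγ.integral_fst (f := fun x => ‖ξ x - gradient ψ x‖ ^ 2) (by fun_prop)]
    exact Real.sqrt_le_iff.2 ⟨hε.le, hψε.le⟩
  calc _ ≤ ∫ p, (‖ξ p.1 - gradient ψ p.1‖ * ‖p.1 - p.2‖ + C * ‖p.1 - p.2‖ ^ 2) ∂γ := by
        rw [← Real.norm_eq_abs]
        refine norm_integral_le_of_norm_le (hint (by fun_prop)) (ae_of_all _ fun p => ?_)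
        have h₁ := hCb p.1 p.2
        have h₂ := abs_real_inner_le_norm (ξ p.1 - gradient ψ p.1) (p.2 - p.1)
        rw [inner_sub_left, norm_sub_rev p.2] at h₂
        rw [Real.norm_eq_abs]
        rw [abs_le] at *
        constructor <;> linarith [h₁.1, h₁.2, h₂.1, h₂.2]
    _ ≤ ε * transportCost γ + C * transportCost γ ^ 2 := by
        rw [integral_add (hint (by fun_prop)) (hint (by fun_prop)), integral_const_mul,
          ← transportCost_sq]
        gcongr

/-- The Wasserstein gradient gives a first-order expansion along all couplings, optimal or not. -/
theorem HasWGradAt.abs_sub_sub_le {φ : Measure (Rd n) → ℝ} {μ : Measure (Rd n)}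
    {ξ : Rd n → Rd n} (h : HasWGradAt φ μ ξ) (hμ : IsPc μ) (hξ : Continuous ξ) {ε : ℝ}
    (hε : 0 < ε) :
    ∃ δ > (0 : ℝ), ∀ ν, IsPc ν → ∀ γ, IsCoupling γ μ ν → transportCost γ < δ →
      |φ ν - φ μ - ∫ p, ⟪ξ p.1, p.2 - p.1⟫ ∂γ| ≤ ε * transportCost γ := by
  obtain ⟨C, hC, ψ, hψ⟩ := exists_abs_integral_inner_sub_le hμ hξ h.1 (ε := ε / 6) (by positivity)
  obtain ⟨δ, hδ, hφ⟩ := h.2 (ε / 6) (by positivity)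
  refine ⟨min δ (ε / (4 * (C + 1))), by positivity, fun ν hν γ hγ hlt => ?_⟩
  obtain ⟨γ₀, hγ₀⟩ := exists_isOptCoupling hμ hν
  have hle := W2_le_transportCost hγ
  have h₁ := hφ ν hν.isP2 γ₀ hγ₀ (hle.trans_lt (hlt.trans_le (min_le_left _ _)))
  have h₂ := hψ ν hν γ hγ
  have h₃ := hψ ν hν γ₀ hγ₀.1
  rw [hγ₀.2] at h₃
  have hW := W2_nonneg μ ν
  have hsq : C * W2 μ ν ^ 2 ≤ C * transportCost γ ^ 2 := by gcongr
  have hsm : C * transportCost γ ^ 2 ≤ ε / 4 * transportCost γ := by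
    have h₄ := (hlt.trans_le (min_le_right _ _)).le
    rw [le_div_iff₀ (by positivity)] at h₄
    have h₅ : C * transportCost γ ≤ ε / 4 := by
      linarith [transportCost_nonneg γ]
    calc C * transportCost γ ^ 2 = C * transportCost γ * transportCost γ := by ring
      _ ≤ _ := mul_le_mul_of_nonneg_right h₅ (transportCost_nonneg γ)
  have hlin : ε / 6 * W2 μ ν ≤ ε / 6 * transportCost γ := by gcongr
  rw [abs_le] at *
  constructor <;> linarith [h₁.1, h₁.2, h₂.1, h₂.2, h₃.1, h₃.2]

/-! ### Displacement along a bounded field -/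

/-- Joint continuity of `(μ, ζ) ↦ D μ ζ` on `P₂(ℝ^n) × ℝ^n`. -/
def ContinuousOnP2 (D : Measure (Rd n) → Rd n → Rd n) : Prop :=
  ∀ (μ : Measure (Rd n)) (ζ : Rd n), IsP2 μ → ∀ ε > (0 : ℝ),
    ∃ δ > (0 : ℝ), ∀ (μ' : Measure (Rd n)) (ζ' : Rd n), IsP2 μ' →
      W2 μ μ' + ‖ζ - ζ'‖ < δ → ‖D μ' ζ' - D μ ζ‖ < ε

/-- The displaced measure `(Id + θ w)_# μ`. -/
abbrev displace (μ : Measure (Rd n)) (w : Rd n → Rd n) (θ : ℝ) : Measure (Rd n) :=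
  μ.map fun x => x + θ • w x

section Displace

variable {μ : Measure (Rd n)} {w : Rd n → Rd n}

theorem IsPc.displace (hμ : IsPc μ) (hwm : Measurable w) (hwb : BddFun w) (θ : ℝ) :
    IsPc (displace μ w θ) := by
  obtain ⟨hp, R, hR⟩ := hμ
  obtain ⟨B, hB⟩ := hwb
  have hm : Measurable fun x => x + θ • w x := by fun_prop
  refine ⟨Measure.isProbabilityMeasure_map hm.aemeasurable, R + |θ| * B, ?_⟩
  rw [Measure.map_apply hm measurableSet_closedBall.compl]
  refine measure_mono_null (fun x hx => ?_) hR
  simp only [mem_preimage, mem_compl_iff, mem_closedBall_zero_iff, not_le] at hx ⊢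
  have h₁ := norm_add_le x (θ • w x)
  rw [norm_smul, Real.norm_eq_abs] at h₁
  have h₂ := mul_le_mul_of_nonneg_left (hB x) (abs_nonneg θ)
  linarith

theorem transportCost_displace_le [IsProbabilityMeasure μ] (hwm : Measurable w) {B : ℝ}
    (hB : ∀ x, ‖w x‖ ≤ B) (θ θ' : ℝ) :
    transportCost (μ.map fun x => (x + θ • w x, x + θ' • w x)) ≤ |θ - θ'| * B := by
  have hB0 : 0 ≤ B := (norm_nonneg _).trans (hB 0)
  refine transportCost_map_le (by fun_prop) (by fun_prop) (by positivity) fun x => ?_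
  rw [add_sub_add_left_eq_sub, ← sub_smul, norm_smul, Real.norm_eq_abs]
  exact mul_le_mul_of_nonneg_left (hB x) (abs_nonneg _)

theorem isCoupling_displace (hwm : Measurable w) (θ θ' : ℝ) :
    IsCoupling (μ.map fun x => (x + θ • w x, x + θ' • w x))
      (displace μ w θ) (displace μ w θ') :=
  isCoupling_map (by fun_prop) (by fun_prop) rfl rfl

theorem ContinuousOnP2.continuous_displace {D : Measure (Rd n) → Rd n → Rd n}
    (hD : ContinuousOnP2 D) (hμ : IsPc μ) (hwm : Measurable w) (hwb : BddFun w) :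
    Continuous fun q : ℝ × Rd n => D (displace μ w q.1) q.2 := by
  have hP := hμ.displace hwm hwb
  have := hμ.1
  obtain ⟨B, hB⟩ := hwb
  rw [continuous_iff_continuousAt]
  rintro ⟨θ, ζ⟩
  rw [Metric.continuousAt_iff']
  intro ε hε
  obtain ⟨δ, hδ, h⟩ := hD _ ζ (hP θ).isP2 ε hε
  have hc : Continuous fun q : ℝ × Rd n => |θ - q.1| * B + ‖ζ - q.2‖ := by fun_prop
  have hev := (hc.tendsto (θ, ζ)).eventually_lt_const (u := δ) (by simpa using hδ)
  filter_upwards [hev] with q hq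
  rw [dist_eq_norm]
  refine h _ _ (hP q.1).isP2 (lt_of_le_of_lt ?_ hq)
  gcongr
  exact (W2_le_transportCost (isCoupling_displace hwm θ q.1)).trans
    (transportCost_displace_le hwm hB θ q.1)

/-- The derivative of a Wasserstein differentiable function along a displacement. -/
theorem hasDerivAt_displace {φ : Measure (Rd n) → ℝ} {ξ : Rd n → Rd n} (hμ : IsPc μ)
    (hwm : Measurable w) (hwb : BddFun w) {θ : ℝ} (h : HasWGradAt φ (displace μ w θ) ξ)
    (hξ : Continuous ξ) :
    HasDerivAt (fun t => φ (displace μ w t)) (∫ ζ, ⟪ξ (ζ + θ • w ζ), w ζ⟫ ∂μ) θ := by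
  have hP := hμ.displace hwm hwb
  have := hμ.1
  obtain ⟨B₀, hB₀⟩ := hwb
  obtain ⟨B, hB, hBpos⟩ : ∃ B, (∀ x, ‖w x‖ ≤ B) ∧ 0 < B :=
    ⟨|B₀| + 1, fun x => (hB₀ x).trans ((le_abs_self _).trans (by simp)), by positivity⟩
  rw [hasDerivAt_iff_isLittleO, Asymptotics.isLittleO_iff]
  intro c hc
  obtain ⟨δ, hδ, hφ⟩ := h.abs_sub_sub_le (hP θ) hξ (ε := c / B) (by positivity)
  have hcont : Continuous fun t => |θ - t| * B := by fun_prop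
  have hev := (hcont.tendsto θ).eventually_lt_const (u := δ) (by simpa using hδ)
  filter_upwards [hev] with t ht
  have hcost := transportCost_displace_le (μ := μ) hwm hB θ t
  have hb := hφ _ (hP t) _ (isCoupling_displace hwm θ t) (hcost.trans_lt ht)
  have hint : ∫ p, ⟪ξ p.1, p.2 - p.1⟫ ∂(μ.map fun x => (x + θ • w x, x + t • w x))
      = (t - θ) • ∫ ζ, ⟪ξ (ζ + θ • w ζ), w ζ⟫ ∂μ := by
    rw [integral_map (by fun_prop) (Continuous.aestronglyMeasurable (by fun_prop)),
      ← integral_smul]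
    simp only [add_sub_add_left_eq_sub, ← sub_smul, inner_smul_right, smul_eq_mul]
  rw [hint] at hb
  rw [Real.norm_eq_abs]
  refine hb.trans ?_
  calc c / B * transportCost _ ≤ c / B * (|θ - t| * B) := by gcongr
    _ = c * ‖t - θ‖ := by rw [Real.norm_eq_abs, abs_sub_comm]; field_simp

theorem integrable_inner_displace (hμ : IsPc μ) (hwm : Measurable w) (hwb : BddFun w)
    {ξ : Rd n → Rd n} (hξ : Continuous ξ) (θ : ℝ) :
    Integrable (fun ζ => ⟪ξ (ζ + θ • w ζ), w ζ⟫) μ := by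
  obtain ⟨B, hB⟩ := hwb
  have h := (hμ.displace hwm ⟨B, hB⟩ θ).integrable hξ.norm
  have hm : Measurable fun x => x + θ • w x := by fun_prop
  rw [integrable_map_measure (hξ.norm.aestronglyMeasurable) hm.aemeasurable] at h
  refine (h.mul_const B).mono' ?_ (ae_of_all _ fun ζ => ?_)
  · exact ((hξ.measurable.comp hm).inner hwm).aestronglyMeasurable
  · refine (norm_inner_le_norm _ _).trans ?_
    exact mul_le_mul_of_nonneg_left (hB ζ) (norm_nonneg _)

theorem continuous_integral_inner_displace {D : ℝ → Rd n → Rd n} (hμ : IsPc μ)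
    (hwm : Measurable w) (hwb : BddFun w) (hD : Continuous fun q : ℝ × Rd n => D q.1 q.2) :
    Continuous fun θ => ∫ ζ, ⟪D θ (ζ + θ • w ζ), w ζ⟫ ∂μ := by
  have hDθ (θ : ℝ) : Continuous (D θ) := hD.comp (Continuous.prodMk_right θ)
  have hmeas (θ : ℝ) := (integrable_inner_displace hμ hwm hwb (hDθ θ) θ).aestronglyMeasurable
  have := hμ.1
  obtain ⟨K, hK, hμK⟩ := hμ.exists_isCompact
  obtain ⟨B, hB⟩ := hwb
  rw [continuous_iff_continuousAt]
  intro θ₀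
  have hcomp := ((isCompact_closedBall θ₀ 1).prod hK).prod (isCompact_closedBall (0 : Rd n) B)
  obtain ⟨M, hM⟩ := hcomp.exists_bound_of_continuousOn
    (f := fun q : (ℝ × Rd n) × Rd n => ⟪D q.1.1 (q.1.2 + q.1.1 • q.2), q.2⟫)
    (Continuous.continuousOn (Continuous.inner
      (hD.comp (f := fun q : (ℝ × Rd n) × Rd n => (q.1.1, q.1.2 + q.1.1 • q.2)) (by fun_prop))
      continuous_snd))
  refine continuousAt_of_dominated (bound := fun _ => M) (Eventually.of_forall hmeas) ?_
    (integrable_const M) (ae_of_all _ fun ζ => ?_)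
  · filter_upwards [closedBall_mem_nhds θ₀ one_pos] with θ hθ
    filter_upwards [hμK] with ζ hζ
    exact hM ((θ, ζ), w ζ) ⟨⟨hθ, hζ⟩, mem_closedBall_zero_iff.2 (hB ζ)⟩
  · refine ContinuousAt.inner ?_ continuousAt_const
    exact (hD.comp (f := fun θ : ℝ => (θ, ζ + θ • w ζ)) (by fun_prop)).continuousAt

end Displace

end WC

/-- Integral-remainder formula for Wasserstein gradients.
Let `φ : P₂(ℝ^d) → ℝ` be Wasserstein differentiable at every measure with gradient
field `Dφ`, with `(μ,ζ) ↦ Dφ[μ](ζ)` continuous. For `μ* ∈ P_c(ℝ^d)`,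
`w ∈ L^∞(ℝ^d,ℝ^d;μ*)`, `ν* = (Id + w)_#μ*` and `μ^θ = (Id + θw)_#μ*`:
`φ(ν*) − φ(μ*) = ∫ Dφ[μ*](ζ)·w(ζ) dμ*(ζ) + R(μ*,w)` with
`R(μ*,w) = ∫₀¹∫ (Dφ[μ^θ](ζ+θw(ζ)) − Dφ[μ*](ζ))·w(ζ) dμ*(ζ) dθ`. -/
theorem integral_remainder_formula {d : ℕ}
    (φ : Measure (Rd d) → ℝ) (Dφ : Measure (Rd d) → Rd d → Rd d)
    (hdiff : ∀ μ : Measure (Rd d), WC.IsP2 μ → WC.HasWGradAt φ μ (Dφ μ))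
    (hcont : ∀ (μ : Measure (Rd d)) (ζ : Rd d), WC.IsP2 μ → ∀ ε > (0 : ℝ),
      ∃ δ > (0 : ℝ), ∀ (μ' : Measure (Rd d)) (ζ' : Rd d), WC.IsP2 μ' →
        WC.W2 μ μ' + ‖ζ - ζ'‖ < δ → ‖Dφ μ' ζ' - Dφ μ ζ‖ < ε)
    (μstar : Measure (Rd d)) (hμstar : WC.IsPc μstar)
    (w : Rd d → Rd d) (hwm : Measurable w) (hwb : WC.BddFun w) :
    φ (Measure.map (fun x => x + w x) μstar) - φ μstar
      = (∫ ζ, ⟪Dφ μstar ζ, w ζ⟫ ∂μstar)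
        + ∫ θ in (0 : ℝ)..1, ∫ ζ,
            ⟪Dφ (Measure.map (fun x => x + θ • w x) μstar) (ζ + θ • w ζ)
              - Dφ μstar ζ, w ζ⟫ ∂μstar := by
  have hc : WC.ContinuousOnP2 Dφ := hcont
  have hP := hμstar.displace hwm hwb
  have hjoint := hc.continuous_displace hμstar hwm hwb
  have hDθ (θ : ℝ) : Continuous (Dφ (WC.displace μstar w θ)) :=
    hjoint.comp (Continuous.prodMk_right θ)
  have hzero : WC.displace μstar w 0 = μstar := by simp [WC.displace]
  have hone : WC.displace μstar w 1 = Measure.map (fun x => x + w x) μstar := by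
    simp [WC.displace]
  have hD0 : Continuous (Dφ μstar) := by simpa only [hzero] using hDθ 0
  have hint0 : Integrable (fun ζ => ⟪Dφ μstar ζ, w ζ⟫) μstar := by
    simpa using WC.integrable_inner_displace hμstar hwm hwb hD0 0
  have hcd := WC.continuous_integral_inner_displace (D := fun θ => Dφ (WC.displace μstar w θ))
    hμstar hwm hwb hjoint
  have hftc := intervalIntegral.integral_eq_sub_of_hasDerivAt (a := 0) (b := 1)
    (fun θ _ => WC.hasDerivAt_displace hμstar hwm hwb (hdiff _ (hP θ).isP2) (hDθ θ))
    (hcd.intervalIntegrable 0 1)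
  have hsplit (θ : ℝ) : ∫ ζ, ⟪Dφ (WC.displace μstar w θ) (ζ + θ • w ζ) - Dφ μstar ζ, w ζ⟫ ∂μstar
      = ∫ ζ, ⟪Dφ (WC.displace μstar w θ) (ζ + θ • w ζ), w ζ⟫ ∂μstar
        - ∫ ζ, ⟪Dφ μstar ζ, w ζ⟫ ∂μstar := by
    simp only [inner_sub_left]
    exact integral_sub (WC.integrable_inner_displace hμstar hwm hwb (hDθ θ) θ) hint0
  simp only [hsplit]
  rw [intervalIntegral.integral_sub (hcd.intervalIntegrable 0 1) intervalIntegrable_const, hftc,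
    hzero, hone]
  simp
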